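/- Fix d ≥ 1, σ > 0, q ∈ [0,1], ε > 0 and δ ∈ [0,1]. Let u ∈ ℝ^d with ‖u‖₂ = 1, and let N(μ, σ²I_d) denote the Gaussian measure on ℝ^d with mean μ and covariance σ²I_d. Then N(0, σ²I_d) and the mixture (1−q)·N(0, σ²I_d) + q·N(u, σ²I_d) are (ε,δ)-indistinguishable if and only if the one-dimensional measures gaussianReal 0 σ² and (1−q)·gaussianReal 0 σ² + q·gaussianReal 1 σ² are (ε,δ)-indistinguishable. -/

import Mathlib

open MeasureTheory ProbabilityTheory Finset

/-- The Gaussian measure `N(m, σ²I_d)` on `ℝ^d`: the pushforward under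
translation by `m` of the `d`-fold product of centered real Gaussians. -/
noncomputable def gaussVec (d : ℕ) (v : NNReal) (m : Fin d → ℝ) :
    Measure (Fin d → ℝ) :=
  Measure.map (fun t => m + t) (Measure.pi fun _ : Fin d => gaussianReal 0 v)

/-- `(ε,δ)`-indistinguishability of two measures. -/
def Indist {Ω : Type*} [MeasurableSpace Ω] (P Q : Measure Ω) (ε δ : ℝ) : Prop :=
  ∀ E : Set Ω, MeasurableSet E →
    P E ≤ ENNReal.ofReal (Real.exp ε) * Q E + ENNReal.ofReal δ ∧
    Q E ≤ ENNReal.ofReal (Real.exp ε) * P E + ENNReal.ofReal δ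

theorem Indist.map {Ω Ω' : Type*} [MeasurableSpace Ω] [MeasurableSpace Ω'] {P Q : Measure Ω}
    {ε δ : ℝ} (h : Indist P Q ε δ) {f : Ω → Ω'} (hf : Measurable f) :
    Indist (P.map f) (Q.map f) ε δ := by
  intro E hE
  rw [Measure.map_apply hf hE, Measure.map_apply hf hE]
  exact h _ (hf hE)

theorem Indist.prod_right {Ω Ω' : Type*} [MeasurableSpace Ω] [MeasurableSpace Ω']
    {P Q : Measure Ω} [SFinite P] [SFinite Q] {ε δ : ℝ} (h : Indist P Q ε δ)
    (ν : Measure Ω') [IsProbabilityMeasure ν] :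
    Indist (P.prod ν) (Q.prod ν) ε δ := by
  have key : ∀ (μ μ' : Measure Ω) [SFinite μ] [SFinite μ'] (c b : ENNReal),
      (∀ E, MeasurableSet E → μ E ≤ c * μ' E + b) →
      ∀ E, MeasurableSet E → μ.prod ν E ≤ c * μ'.prod ν E + b := by
    intro μ μ' _ _ c b hμ E hE
    rw [Measure.prod_apply_symm hE, Measure.prod_apply_symm hE]
    calc ∫⁻ y, μ ((fun x => (x, y)) ⁻¹' E) ∂ν
        ≤ ∫⁻ y, (c * μ' ((fun x => (x, y)) ⁻¹' E) + b) ∂ν :=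
          lintegral_mono fun y => hμ _ (measurable_prodMk_right hE)
      _ = c * ∫⁻ y, μ' ((fun x => (x, y)) ⁻¹' E) ∂ν + b := by
          rw [lintegral_add_right _ measurable_const,
            lintegral_const_mul _ (measurable_measure_prodMk_right hE)]
          simp
  exact fun E hE => ⟨key P Q _ _ (fun F hF => (h F hF).1) E hE,
    key Q P _ _ (fun F hF => (h F hF).2) E hE⟩

theorem apply_eq_sum_mul_apply_single {ι : Type*} [Fintype ι] [DecidableEq ι]
    (L : StrongDual ℝ (ι → ℝ)) (x : ι → ℝ) : L x = ∑ i, x i * L (Pi.single i 1) := by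
  conv_lhs => rw [pi_eq_sum_univ' x]
  rw [map_sum]
  refine Finset.sum_congr rfl fun i _ => ?_
  rw [map_smul, smul_eq_mul]

theorem charFunDual_pi_gaussianReal {ι : Type*} [Fintype ι] [DecidableEq ι] (v : NNReal)
    (L : StrongDual ℝ (ι → ℝ)) :
    charFunDual (Measure.pi fun _ : ι => gaussianReal 0 v) L =
      Complex.exp (-(v * (∑ i, L (Pi.single i 1) ^ 2 : ℝ) / 2)) := by
  have hexp : ∀ x : ι → ℝ, Complex.exp (L x * Complex.I) =
      ∏ i, Complex.exp (L (Pi.single i 1) * x i * Complex.I) := by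
    intro x
    rw [apply_eq_sum_mul_apply_single L x, ← Complex.exp_sum]
    push_cast
    simp_rw [Finset.sum_mul, mul_comm (x _ : ℂ)]
  have h := integral_fintype_prod_eq_prod (μ := fun _ : ι => gaussianReal 0 v)
    (fun i (x : ℝ) => Complex.exp (L (Pi.single i 1) * x * Complex.I))
  simp_rw [← charFun_apply_real, charFun_gaussianReal, ← Complex.exp_sum] at h
  rw [charFunDual_apply]
  simp only [hexp, ← Complex.exp_sum]
  rw [h]
  congr 1
  simp [Finset.mul_sum, Finset.sum_div]

/-- The linear functional `x ↦ ∑ i, u i * x i`. -/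
noncomputable def dotCLM {d : ℕ} (u : Fin d → ℝ) : StrongDual ℝ (Fin d → ℝ) :=
  ∑ i, u i • ContinuousLinearMap.proj i

theorem dotCLM_apply {d : ℕ} (u x : Fin d → ℝ) : dotCLM u x = ∑ i, u i * x i := by
  simp [dotCLM]

/-- The linear map `(t, z) ↦ t • u + (z - ⟨u, z⟩ • u)`, replacing the component of `z` along `u`
by `t`. -/
noncomputable def replaceComponent {d : ℕ} (u : Fin d → ℝ) :
    ℝ × (Fin d → ℝ) →L[ℝ] (Fin d → ℝ) :=
  (ContinuousLinearMap.fst ℝ ℝ (Fin d → ℝ)).smulRight u +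
    (ContinuousLinearMap.id ℝ (Fin d → ℝ) - (dotCLM u).smulRight u).comp
      (ContinuousLinearMap.snd ℝ ℝ (Fin d → ℝ))

theorem replaceComponent_apply {d : ℕ} (u : Fin d → ℝ) (p : ℝ × (Fin d → ℝ)) :
    replaceComponent u p = p.1 • u + (p.2 - dotCLM u p.2 • u) := by
  simp [replaceComponent]

theorem map_dotCLM_pi_gaussianReal {d : ℕ} (v : NNReal) {u : Fin d → ℝ}
    (hu : ∑ i, u i ^ 2 = 1) :
    (Measure.pi fun _ : Fin d => gaussianReal 0 v).map (dotCLM u) = gaussianReal 0 v := by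
  have := Measure.isFiniteMeasure_map (Measure.pi fun _ : Fin d => gaussianReal 0 v) (dotCLM u)
  refine Measure.ext_of_charFun (funext fun t => ?_)
  rw [charFun_map_eq_charFunDual_smul, charFunDual_pi_gaussianReal, charFun_gaussianReal]
  have : ∑ i, (t • dotCLM u) (Pi.single i 1) ^ 2 = t ^ 2 := by
    simp [dotCLM_apply, Pi.single_apply, mul_pow, ← Finset.mul_sum, hu]
  rw [this]
  simp

theorem map_replaceComponent_prod {d : ℕ} (v : NNReal) {u : Fin d → ℝ}
    (hu : ∑ i, u i ^ 2 = 1) :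
    ((gaussianReal 0 v).prod (Measure.pi fun _ : Fin d => gaussianReal 0 v)).map
      (replaceComponent u) = Measure.pi fun _ : Fin d => gaussianReal 0 v := by
  have := Measure.isFiniteMeasure_map
    ((gaussianReal 0 v).prod (Measure.pi fun _ : Fin d => gaussianReal 0 v)) (replaceComponent u)
  refine Measure.ext_of_charFunDual (funext fun L => ?_)
  rw [charFunDual_map, charFunDual_prod, charFunDual_pi_gaussianReal, charFunDual_pi_gaussianReal,
    charFunDual_eq_charFun_map_one, gaussianReal_map_continuousLinearMap, charFun_gaussianReal,
    ← Complex.exp_add]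
  have hLu := apply_eq_sum_mul_apply_single L u
  have hsum : ∑ i, (L (Pi.single i 1) - u i * L u) ^ 2 =
      ∑ i, L (Pi.single i 1) ^ 2 - L u ^ 2 := by
    have : ∀ i, (L (Pi.single i 1) - u i * L u) ^ 2 =
        L (Pi.single i 1) ^ 2 - 2 * L u * (u i * L (Pi.single i 1)) + L u ^ 2 * u i ^ 2 :=
      fun i => by ring
    simp_rw [this]
    rw [Finset.sum_add_distrib, Finset.sum_sub_distrib, ← Finset.mul_sum, ← Finset.mul_sum, hu,
      ← hLu]
    ring
  have h2 : ∀ i, ((L.comp (replaceComponent u)).comp (.inr ℝ ℝ (Fin d → ℝ))) (Pi.single i 1) =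
      L (Pi.single i 1) - u i * L u := by
    intro i
    simp [replaceComponent_apply, dotCLM_apply, Pi.single_apply]
  have h1 : ((L.comp (replaceComponent u)).comp (.inl ℝ ℝ (Fin d → ℝ))) 1 = L u := by
    simp [replaceComponent_apply]
  simp_rw [h2, hsum, h1, map_zero]
  congr 1
  have : ((L u ^ 2).toNNReal : ℝ) = L u ^ 2 := Real.coe_toNNReal _ (sq_nonneg _)
  rw [NNReal.coe_mul, this]
  push_cast
  ring

theorem gaussVec_map_dotCLM {d : ℕ} (v : NNReal) {u : Fin d → ℝ} (hu : ∑ i, u i ^ 2 = 1) (m : ℝ) :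
    (gaussVec d v (m • u)).map (dotCLM u) = gaussianReal m v := by
  have huu : dotCLM u u = 1 := by simpa [dotCLM_apply, pow_two] using hu
  have hcomp : (dotCLM u : (Fin d → ℝ) → ℝ) ∘ (fun t => m • u + t) =
      (fun x => m + x) ∘ dotCLM u := by
    ext t
    simp [huu]
  rw [gaussVec, Measure.map_map (by fun_prop) (by fun_prop), hcomp,
    ← Measure.map_map (by fun_prop) (by fun_prop), map_dotCLM_pi_gaussianReal v hu,
    gaussianReal_map_const_add, zero_add]

theorem prod_map_replaceComponent {d : ℕ} (v : NNReal) {u : Fin d → ℝ}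
    (hu : ∑ i, u i ^ 2 = 1) (m : ℝ) :
    ((gaussianReal m v).prod (Measure.pi fun _ : Fin d => gaussianReal 0 v)).map
      (replaceComponent u) = gaussVec d v (m • u) := by
  have hcomp : (replaceComponent u : ℝ × (Fin d → ℝ) → Fin d → ℝ) ∘
      Prod.map (fun x => m + x) id = (fun t => m • u + t) ∘ replaceComponent u := by
    ext p
    simp [replaceComponent_apply]
    ring
  have hm : gaussianReal m v = (gaussianReal 0 v).map (fun x => m + x) := by
    rw [gaussianReal_map_const_add, zero_add]
  have hprod := Measure.map_prod_map (gaussianReal 0 v)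
    (Measure.pi fun _ : Fin d => gaussianReal 0 v) (measurable_const_add m) measurable_id
  rw [Measure.map_id] at hprod
  rw [hm, hprod, Measure.map_map (by fun_prop) (by fun_prop), hcomp,
    ← Measure.map_map (by fun_prop) (by fun_prop), map_replaceComponent_prod v hu, gaussVec]


/-- Rotation-and-translation reduction: for a unit vector `u`, the pair
`(N(0,σ²I_d), (1-q)N(0,σ²I_d) + qN(u,σ²I_d))` is (ε,δ)-indistinguishable iff
the corresponding one-dimensional pair is. -/
theorem gaussian_mixture_reduction_iff_1d
    (d : ℕ) (hd : 1 ≤ d) (σ : ℝ) (hσ : 0 < σ)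
    (q : ℝ) (hq : q ∈ Set.Icc (0 : ℝ) 1)
    (ε δ : ℝ) (hε : 0 < ε) (hδ : δ ∈ Set.Icc (0 : ℝ) 1)
    (u : Fin d → ℝ) (hu : ∑ i, (u i) ^ 2 = 1) :
    Indist (gaussVec d (Real.toNNReal (σ ^ 2)) 0)
        (ENNReal.ofReal (1 - q) • gaussVec d (Real.toNNReal (σ ^ 2)) 0 +
         ENNReal.ofReal q • gaussVec d (Real.toNNReal (σ ^ 2)) u) ε δ ↔
    Indist (gaussianReal 0 (Real.toNNReal (σ ^ 2)))
        (ENNReal.ofReal (1 - q) • gaussianReal 0 (Real.toNNReal (σ ^ 2)) +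
         ENNReal.ofReal q • gaussianReal 1 (Real.toNNReal (σ ^ 2))) ε δ := by
  have h0 := gaussVec_map_dotCLM (Real.toNNReal (σ ^ 2)) hu 0
  have h1 := gaussVec_map_dotCLM (Real.toNNReal (σ ^ 2)) hu 1
  have k0 := prod_map_replaceComponent (Real.toNNReal (σ ^ 2)) hu 0
  have k1 := prod_map_replaceComponent (Real.toNNReal (σ ^ 2)) hu 1
  rw [zero_smul] at h0 k0
  rw [one_smul] at h1 k1
  constructor
  · intro h
    have := h.map (dotCLM u).continuous.measurable
    rwa [Measure.map_add _ _ (by fun_prop), Measure.map_smul, Measure.map_smul, h0, h1] at this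
  · intro h
    have := (h.prod_right (Measure.pi fun _ : Fin d => gaussianReal 0 (Real.toNNReal (σ ^ 2)))).map
      (replaceComponent u).continuous.measurable
    rwa [Measure.add_prod, Measure.prod_smul_left, Measure.prod_smul_left,
      Measure.map_add _ _ (by fun_prop), Measure.map_smul, Measure.map_smul, k0, k1] at this
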